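/- arXiv:math/0403073 — 4 statements merged into one kernel-verified Lean document; each statement's English description precedes it below -/
import Mathlib

section
/- Let q : ℝ → L(E) be a C¹ family of orthogonal projections, p(s) := I − q(s), and Γ(s) := q′(s)∘p(s) + p′(s)∘q(s). Then Γ(s) is skew-adjoint for every s, i.e. Γ(s)* = −Γ(s). Consequently, if u : ℝ → L(E) is C¹ with u′(s) = −Γ(s)∘u(s) for all s and u(0) = I, then u(s)*∘u(s) = I for all s, i.e. each u(s) is an orthogonal operator on E. -/
section NormedAlgebra

variable {A : Type*} [NormedRing A] [NormedAlgebra ℝ A]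

/-- The derivative of a curve of idempotents satisfies the Leibniz rule for `q * q = q`. -/
theorem HasDerivAt.eq_mul_add_mul_of_isIdempotentElem {q : ℝ → A} {q' : A} {s : ℝ}
    (hq : HasDerivAt q q' s) (hidem : ∀ t, IsIdempotentElem (q t)) :
    q' = q' * q s + q s * q' := by
  have h := hq.mul hq
  rw [show q * q = q from funext hidem] at h
  exact hq.unique h

/-- The connection form of a curve of idempotents is the commutator of the curve and its derivative. -/
theorem HasDerivAt.connectionForm_eq_commutator {q : ℝ → A} {q' : A} {s : ℝ}
    (hq : HasDerivAt q q' s) (hidem : ∀ t, IsIdempotentElem (q t)) :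
    q' * (1 - q s) + -q' * q s = q s * q' - q' * q s := by
  have h := hq.eq_mul_add_mul_of_isIdempotentElem hidem
  have h' : q s * q' = q' - q' * q s := eq_sub_of_add_eq' h.symm
  rw [h']
  noncomm_ring

variable [StarRing A] [ContinuousStar A] [StarModule ℝ A]

/-- The derivative of a curve of self-adjoint elements is self-adjoint. -/
theorem HasDerivAt.isSelfAdjoint {q : ℝ → A} {q' : A} {s : ℝ}
    (hq : HasDerivAt q q' s) (hsa : ∀ t, IsSelfAdjoint (q t)) : IsSelfAdjoint q' := by
  have h := hq.star
  rw [show (fun t => star (q t)) = q from funext hsa] at h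
  exact h.unique hq

/-- A solution of `deriv u = -Γ u` with `Γ` skew-adjoint and `u 0 = 1` satisfies `u* u = 1`. -/
theorem star_mul_self_eq_one_of_hasDerivAt_neg_mul {Γ u : ℝ → A}
    (hΓ : ∀ s, star (Γ s) = -Γ s) (hu : ∀ s, HasDerivAt u (-(Γ s * u s)) s)
    (hu₀ : u 0 = 1) (s : ℝ) : star (u s) * u s = 1 := by
  have h : ∀ t, HasDerivAt (fun t => star (u t) * u t) 0 t := fun t => by
    refine ((hu t).star.mul (hu t)).congr_deriv ?_
    rw [star_neg, star_mul, hΓ]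
    noncomm_ring
  have h_const := is_const_of_deriv_eq_zero (fun t => (h t).differentiableAt)
    (fun t => (h t).deriv) s 0
  simpa [hu₀] using h_const

end NormedAlgebra

/-- For a `C¹` family of orthogonal projections `q` with `p := I − q`, the connection form
`Γ := q′p + p′q` is skew-adjoint; consequently the solution of `u′ = −Γu`, `u(0) = I` is
orthogonal for all `s`: `u(s)* u(s) = I`. -/
theorem connection_form_skew_adjoint_and_solution_orthogonal
    (E : Type*) [NormedAddCommGroup E] [InnerProductSpace ℝ E] [FiniteDimensional ℝ E]
    (q : ℝ → (E →L[ℝ] E)) (hq : ContDiff ℝ 1 q)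
    (hsa : ∀ s, ContinuousLinearMap.adjoint (q s) = q s)
    (hidem : ∀ s, (q s).comp (q s) = q s)
    (p : ℝ → (E →L[ℝ] E)) (hp : ∀ s, p s = ContinuousLinearMap.id ℝ E - q s)
    (Γ : ℝ → (E →L[ℝ] E))
    (hΓ : ∀ s, Γ s = (deriv q s).comp (p s) + (deriv p s).comp (q s)) :
    (∀ s, ContinuousLinearMap.adjoint (Γ s) = -Γ s) ∧
    ∀ u : ℝ → (E →L[ℝ] E), ContDiff ℝ 1 u →
      u 0 = ContinuousLinearMap.id ℝ E →
      (∀ s, deriv u s = -(Γ s).comp (u s)) →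
      ∀ s, (ContinuousLinearMap.adjoint (u s)).comp (u s) =
        ContinuousLinearMap.id ℝ E := by
  have hq' : ∀ s, HasDerivAt q (deriv q s) s := fun s =>
    (hq.differentiable one_ne_zero s).hasDerivAt
  have hp' : ∀ s, deriv p s = -deriv q s := fun s => by
    rw [funext hp]
    exact ((hq' s).const_sub _).deriv
  have h_skew : ∀ s, star (Γ s) = -Γ s := fun s => by
    have h_comm : Γ s = q s * deriv q s - deriv q s * q s := by
      rw [hΓ, hp, hp']
      exact (hq' s).connectionForm_eq_commutator hidem
    have h_q : star (q s) = q s := hsa s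
    rw [h_comm, star_sub, star_mul, star_mul, h_q, (hq' s).isSelfAdjoint hsa, neg_sub]
  refine ⟨h_skew, fun u hu hu₀ hu' s => ?_⟩
  refine star_mul_self_eq_one_of_hasDerivAt_neg_mul h_skew (fun t => ?_) hu₀ s
  exact (hu.differentiable one_ne_zero t).hasDerivAt.congr_deriv (hu' t)
end

section
/- Let X, Y : ℝ × ℝ^N → ℝ^N be smooth time-dependent vector fields, fix x ∈ ℝ^N, and suppose φ : ℝ × ℝ × ℝ^N → ℝ^N is a smooth map such that for all (s, t, y): ∂_t φ(s, t, y) = X(t, φ(s, t, y)) + s·Y(t, φ(s, t, y)) and φ(s, 0, y) = y, and such that the space differential Z_t := (D_y φ)(0, t, x) : ℝ^N → ℝ^N is invertible for every t. Then the derivative of the perturbed flow in the perturbation parameter is given by the Duhamel-type formula ∂_s|_{s=0} φ(s, t, x) = Z_t ∫₀ᵗ Z_τ⁻¹ Y(τ, φ(0, τ, x)) dτ. -/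
open scoped ContDiff

/-- Along the time direction, the mixed derivative of a smooth `φ (s, t, y)` may be computed
by differentiating the time derivative `G` in the direction `v`. -/
theorem hasDerivAt_fderiv_time {E F : Type*} [NormedAddCommGroup E] [NormedSpace ℝ E]
    [NormedAddCommGroup F] [NormedSpace ℝ F] {φ G : ℝ × ℝ × E → F} (hφ : ContDiff ℝ ∞ φ)
    (hG : ∀ p, fderiv ℝ φ p (0, 1, 0) = G p) (s t : ℝ) (x : E) {G' : ℝ × ℝ × E →L[ℝ] F}
    (hG' : HasFDerivAt G G' (s, t, x)) :
    HasDerivAt (fun τ => fderiv ℝ φ (s, τ, x)) G' t := by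
  have hd : HasFDerivAt (fderiv ℝ φ) (fderiv ℝ (fderiv ℝ φ) (s, t, x)) (s, t, x) :=
    ((hφ.fderiv_right (m := ∞) le_rfl).differentiable (by simp) _).hasFDerivAt
  have hc : HasDerivAt (fun τ : ℝ => (s, τ, x)) ((0 : ℝ), (1 : ℝ), (0 : E)) t :=
    (hasDerivAt_const t s).prodMk ((hasDerivAt_id t).prodMk (hasDerivAt_const t x))
  have hsymm : IsSymmSndFDerivAt ℝ φ (s, t, x) :=
    hφ.contDiffAt.isSymmSndFDerivAt (by
      rw [minSmoothness_of_isRCLikeNormedField]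
      exact WithTop.coe_le_coe.2 le_top)
  have hG₂ : HasFDerivAt G ((fderiv ℝ (fderiv ℝ φ) (s, t, x)).flip (0, 1, 0)) (s, t, x) := by
    have := hd.clm_apply (hasFDerivAt_const ((0 : ℝ), (1 : ℝ), (0 : E)) (s, t, x))
    simpa [hG] using this
  have key : fderiv ℝ (fderiv ℝ φ) (s, t, x) (0, 1, 0) = G' := by
    refine ContinuousLinearMap.ext fun v => ?_
    rw [hG'.unique hG₂]
    exact hsymm _ _
  rw [← key]
  exact hd.comp_hasDerivAt t hc

/-- Variation of constants: if `Z` is differentiable with inverse `Zinv`, and `u` solves the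
inhomogeneous equation whose homogeneous part is solved by `Z`, with `u 0 = 0`, then
`u` is given by Duhamel's formula. -/
theorem eq_apply_integral_of_hasDerivAt {E : Type*} [NormedAddCommGroup E] [NormedSpace ℝ E]
    [CompleteSpace E] {Z Zinv A : ℝ → E →L[ℝ] E} {u f : ℝ → E}
    (hZ : ∀ t, HasDerivAt Z ((A t).comp (Z t)) t)
    (hinv : ∀ t, (Z t).comp (Zinv t) = ContinuousLinearMap.id ℝ E ∧
      (Zinv t).comp (Z t) = ContinuousLinearMap.id ℝ E)
    (hu : ∀ t, HasDerivAt u (A t (u t) + f t) t) (hf : Continuous f) (hu0 : u 0 = 0) (t : ℝ) :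
    u t = Z t (∫ τ in (0 : ℝ)..t, Zinv τ (f τ)) := by
  have hright : ∀ t v, Z t (Zinv t v) = v := fun t v => DFunLike.congr_fun (hinv t).1 v
  have hleft : ∀ t v, Zinv t (Z t v) = v := fun t v => DFunLike.congr_fun (hinv t).2 v
  have hZd : Differentiable ℝ Zinv := by
    intro t
    let U : ℝ → (E →L[ℝ] E)ˣ := fun t => ⟨Z t, Zinv t, (hinv t).1, (hinv t).2⟩
    have heq : Zinv = fun t => Ring.inverse (Z t) :=
      funext fun t => (Ring.inverse_unit (U t)).symm
    have h := (hasFDerivAt_ringInverse (𝕜 := ℝ) (U t)).differentiableAt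
    rw [heq]
    exact DifferentiableAt.comp t h (hZ t).differentiableAt
  have hW : ∀ t, HasDerivAt (fun τ => Zinv τ (u τ)) (Zinv t (f t)) t := by
    intro t
    have hd := ((hZd t).hasDerivAt.clm_apply (hu t))
    have hZW := (hZ t).clm_apply hd
    simp only [hright] at hZW
    have h := hZW.unique (hu t)
    simp only [ContinuousLinearMap.comp_apply, hright, add_right_inj] at h
    rw [← h, hleft]
    exact hd
  rw [intervalIntegral.integral_eq_sub_of_hasDerivAt (fun τ _ => hW τ)
    ((hZd.continuous.clm_apply hf).intervalIntegrable _ _), hu0, map_zero, sub_zero, hright]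

/-- Duhamel's formula for the derivative of a smooth perturbed flow with respect to the
perturbation parameter, in a Banach space. -/
theorem hasDerivAt_perturbed_flow {E : Type*} [NormedAddCommGroup E] [NormedSpace ℝ E]
    [CompleteSpace E]
    (X Y : ℝ × E → E)
    (hX : ContDiff ℝ ∞ X) (hY : ContDiff ℝ ∞ Y)
    (x : E)
    (φ : ℝ × ℝ × E → E)
    (hφ : ContDiff ℝ ∞ φ)
    (hflow : ∀ (s t : ℝ) (y : E),
      HasDerivAt (fun t' => φ (s, t', y))
        (X (t, φ (s, t, y)) + s • Y (t, φ (s, t, y))) t)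
    (hinit : ∀ (s : ℝ) (y : E), φ (s, 0, y) = y)
    (Z : ℝ → E →L[ℝ] E)
    (hZ : ∀ t, Z t = fderiv ℝ (fun y => φ (0, t, y)) x)
    (Zinv : ℝ → E →L[ℝ] E)
    (hZinv : ∀ t,
      (Z t).comp (Zinv t) = ContinuousLinearMap.id ℝ E ∧
      (Zinv t).comp (Z t) = ContinuousLinearMap.id ℝ E) :
    ∀ t : ℝ,
      HasDerivAt (fun s => φ (s, t, x))
        (Z t (∫ τ in (0 : ℝ)..t, Zinv τ (Y (τ, φ (0, τ, x))))) 0 := by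
  have hφd : ∀ p, HasFDerivAt φ (fderiv ℝ φ p) p := fun p =>
    (hφ.differentiable (by simp) p).hasFDerivAt
  let G : ℝ × ℝ × E → E :=
    fun p => X (p.2.1, φ p) + p.1 • Y (p.2.1, φ p)
  have hG : ∀ p, fderiv ℝ φ p (0, 1, 0) = G p := by
    rintro ⟨s, t, y⟩
    have hc : HasDerivAt (fun τ : ℝ => (s, τ, y)) ((0 : ℝ), (1 : ℝ), (0 : E)) t :=
      (hasDerivAt_const t s).prodMk ((hasDerivAt_id t).prodMk (hasDerivAt_const t y))
    exact ((hφd (s, t, y)).comp_hasDerivAt t hc).unique (hflow s t y)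
  let A : ℝ → E →L[ℝ] E := fun t =>
    (fderiv ℝ X (t, φ (0, t, x))).comp (ContinuousLinearMap.inr ℝ ℝ E)
  let D : ℝ → ℝ × ℝ × E →L[ℝ] E := fun t => fderiv ℝ φ (0, t, x)
  have hs : ∀ t, HasDerivAt (fun s => φ (s, t, x)) (D t (1, 0, 0)) 0 := by
    intro t
    have hc : HasDerivAt (fun s : ℝ => (s, t, x)) ((1 : ℝ), (0 : ℝ), (0 : E)) 0 :=
      (hasDerivAt_id (0 : ℝ)).prodMk (hasDerivAt_const _ (t, x))
    exact (hφd (0, t, x)).comp_hasDerivAt 0 hc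
  have hZD : ∀ t, Z t = (D t).comp
      ((ContinuousLinearMap.inr ℝ ℝ (ℝ × E)).comp (ContinuousLinearMap.inr ℝ ℝ E)) := by
    intro t
    rw [hZ]
    exact ((hφd (0, t, x)).comp x
      ((hasFDerivAt_prodMk_right (0 : ℝ) (t, x)).comp x (hasFDerivAt_prodMk_right t x))).fderiv
  have hD : ∀ t, ∃ D' : ℝ × ℝ × E →L[ℝ] E, HasDerivAt D D' t ∧
      ∀ a w, D' (a, 0, w) = A t (D t (a, 0, w)) + a • Y (t, φ (0, t, x)) := by
    intro t
    have hpair := (hasFDerivAt_id (𝕜 := ℝ) ((0 : ℝ), t, x)).snd.fst.prodMk (hφd (0, t, x))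
    have hXc := ((hX.differentiable (by simp) (t, φ (0, t, x))).hasFDerivAt).comp
      ((0 : ℝ), t, x) hpair
    have hYc := ((hY.differentiable (by simp) (t, φ (0, t, x))).hasFDerivAt).comp
      ((0 : ℝ), t, x) hpair
    have hGd := hXc.add ((hasFDerivAt_id (𝕜 := ℝ) ((0 : ℝ), t, x)).fst.smul hYc)
    refine ⟨_, hasDerivAt_fderiv_time hφ hG 0 t x hGd, fun a w => ?_⟩
    simp [A, D]
  intro t
  have hu := eq_apply_integral_of_hasDerivAt (Z := Z) (Zinv := Zinv) (A := A)
    (u := fun τ => D τ (1, 0, 0)) (f := fun τ => Y (τ, φ (0, τ, x))) ?_ hZinv ?_ ?_ ?_ t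
  · rw [← hu]
    exact hs t
  · intro t
    obtain ⟨D', hD', hval⟩ := hD t
    have h := hD'.clm_comp (hasDerivAt_const t
      ((ContinuousLinearMap.inr ℝ ℝ (ℝ × E)).comp (ContinuousLinearMap.inr ℝ ℝ E)))
    rw [← funext hZD] at h
    convert h using 1
    ext1 w
    simpa [hZD] using (hval 0 w).symm
  · intro t
    obtain ⟨D', hD', hval⟩ := hD t
    have h := hD'.clm_apply (hasDerivAt_const t ((1 : ℝ), (0 : ℝ), (0 : E)))
    simpa [hval] using h
  · have := hφ.continuous
    have := hY.continuous
    fun_prop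
  · have h := hs 0
    simp only [hinit] at h
    exact h.unique (hasDerivAt_const _ _)

/-- Duhamel formula for the derivative of a flow with respect to a perturbation parameter:
if `∂_t φ(s,t,y) = X(t, φ(s,t,y)) + s·Y(t, φ(s,t,y))`, `φ(s,0,y) = y`, and
`Z_t = (D_y φ)(0,t,x)` is invertible, then
`∂_s|₀ φ(s,t,x) = Z_t ∫₀ᵗ Z_τ⁻¹ Y(τ, φ(0,τ,x)) dτ`. -/
theorem perturbed_flow_derivative_duhamel
    (N : ℕ)
    (X Y : ℝ × EuclideanSpace ℝ (Fin N) → EuclideanSpace ℝ (Fin N))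
    (hX : ContDiff ℝ ∞ X) (hY : ContDiff ℝ ∞ Y)
    (x : EuclideanSpace ℝ (Fin N))
    (φ : ℝ × ℝ × EuclideanSpace ℝ (Fin N) → EuclideanSpace ℝ (Fin N))
    (hφ : ContDiff ℝ ∞ φ)
    (hflow : ∀ (s t : ℝ) (y : EuclideanSpace ℝ (Fin N)),
      HasDerivAt (fun t' => φ (s, t', y))
        (X (t, φ (s, t, y)) + s • Y (t, φ (s, t, y))) t)
    (hinit : ∀ (s : ℝ) (y : EuclideanSpace ℝ (Fin N)), φ (s, 0, y) = y)
    (Z : ℝ → EuclideanSpace ℝ (Fin N) →L[ℝ] EuclideanSpace ℝ (Fin N))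
    (hZ : ∀ t, Z t = fderiv ℝ (fun y => φ (0, t, y)) x)
    (Zinv : ℝ → EuclideanSpace ℝ (Fin N) →L[ℝ] EuclideanSpace ℝ (Fin N))
    (hZinv : ∀ t,
      (Z t).comp (Zinv t) = ContinuousLinearMap.id ℝ (EuclideanSpace ℝ (Fin N)) ∧
      (Zinv t).comp (Z t) = ContinuousLinearMap.id ℝ (EuclideanSpace ℝ (Fin N))) :
    ∀ t : ℝ,
      HasDerivAt (fun s => φ (s, t, x))
        (Z t (∫ τ in (0 : ℝ)..t, Zinv τ (Y (τ, φ (0, τ, x))))) 0 :=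
  hasDerivAt_perturbed_flow X Y hX hY x φ hφ hflow hinit Z hZ Zinv hZinv
end

section
/- Let X : ℝ × ℝ^N → ℝ^N and Y : ℝ^N → ℝ^N be smooth, and suppose φ : ℝ × ℝ^N → ℝ^N is a smooth map with ∂_t φ(t, y) = X(t, φ(t, y)) for all (t, y), φ(0, y) = y, and such that Z_t(y) := (D_y φ)(t, y) is invertible for all (t, y). Then for every y and t, d/dt [ Z_t(y)⁻¹ (Y(φ(t, y))) ] = Z_t(y)⁻¹ ([X_t, Y](φ(t, y))), where [X_t, Y](z) := (DY)(z)(X(t, z)) − (D_z X)(t, z)(Y(z)) is the Lie bracket of the vector fields X(t, ·) and Y. -/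
open scoped ContDiff

section FlowDerivatives

variable {E : Type*} [NormedAddCommGroup E] [NormedSpace ℝ E]

/-- The time derivative of the spatial differential of a `C²` map is the spatial differential of
its time derivative. -/
theorem hasDerivAt_fderiv_snd_of_hasDerivAt_fst {φ : ℝ × E → E} (hφ : ContDiff ℝ 2 φ)
    {f : ℝ → E → E} (hf : ∀ t y, HasDerivAt (fun t' => φ (t', y)) (f t y) t) (t : ℝ) (y : E) :
    HasDerivAt (fun t' => fderiv ℝ (fun y' => φ (t', y')) y) (fderiv ℝ (f t) y) t := by
  have hd : Differentiable ℝ φ := hφ.differentiable (by norm_num)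
  have hd2 : HasFDerivAt (fderiv ℝ φ) (fderiv ℝ (fderiv ℝ φ) (t, y)) (t, y) :=
    ((hφ.fderiv_right (m := 1) (by norm_num)).differentiable (by norm_num) (t, y)).hasFDerivAt
  have hsnd : ∀ t' y', HasFDerivAt (fun y' => (t', y')) (ContinuousLinearMap.inr ℝ ℝ E) y' :=
    fun t' y' => hasFDerivAt_prodMk_right t' y'
  have hfst : ∀ t' y', HasDerivAt (fun t' : ℝ => (t', y')) ((1 : ℝ), (0 : E)) t' :=
    fun t' y' => (hasDerivAt_id t').prodMk (hasDerivAt_const t' y')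
  have hspace : (fun t' => fderiv ℝ (fun y' => φ (t', y')) y) =
      fun t' => (fderiv ℝ φ (t', y)).comp (ContinuousLinearMap.inr ℝ ℝ E) :=
    funext fun t' => ((hd (t', y)).hasFDerivAt.comp y (hsnd t' y)).fderiv
  have htime : f t = fun y' => fderiv ℝ φ (t, y') (1, 0) :=
    funext fun y' => (hf t y').unique ((hd (t, y')).hasFDerivAt.comp_hasDerivAt t (hfst t y'))
  have hsymm : IsSymmSndFDerivAt ℝ φ (t, y) :=
    hφ.contDiffAt.isSymmSndFDerivAt (by simp)
  have hcurve : HasDerivAt (fun t' => fderiv ℝ φ (t', y))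
      (fderiv ℝ (fderiv ℝ φ) (t, y) (1, 0)) t := hd2.comp_hasDerivAt t (hfst t y)
  have hslice : HasFDerivAt (fun y' => fderiv ℝ φ (t, y'))
      ((fderiv ℝ (fderiv ℝ φ) (t, y)).comp (ContinuousLinearMap.inr ℝ ℝ E)) y :=
    hd2.comp y (hsnd t y)
  have hmixed : fderiv ℝ (f t) y =
      (fderiv ℝ (fderiv ℝ φ) (t, y) (1, 0)).comp (ContinuousLinearMap.inr ℝ ℝ E) := by
    rw [htime, (hslice.clm_apply (hasFDerivAt_const ((1 : ℝ), (0 : E)) y)).fderiv]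
    ext v
    simpa using hsymm.eq (0, v) (1, 0)
  rw [hspace, hmixed]
  simpa using hcurve.clm_comp (hasDerivAt_const t (ContinuousLinearMap.inr ℝ ℝ E))

/-- The derivative of a pointwise inverse of a differentiable curve of invertible operators. -/
theorem HasDerivAt.clm_inverse [CompleteSpace E] {A B : ℝ → E →L[ℝ] E} {A' : E →L[ℝ] E} {t : ℝ}
    (hA : HasDerivAt A A' t) (hAB : ∀ s, A s * B s = 1) (hBA : ∀ s, B s * A s = 1) :
    HasDerivAt B (-(B t * A' * B t)) t := by
  have hB : B = fun s => Ring.inverse (A s) :=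
    funext fun s => (Ring.inverse_unit (⟨A s, B s, hAB s, hBA s⟩ : (E →L[ℝ] E)ˣ)).symm
  have h := (hasFDerivAt_ringInverse
    (⟨A t, B t, hAB t, hBA t⟩ : (E →L[ℝ] E)ˣ)).comp_hasDerivAt t hA
  have h' : HasDerivAt (fun s => Ring.inverse (A s)) (-(B t * A' * B t)) t := by
    simpa [Function.comp_def] using h
  rwa [← hB] at h'

end FlowDerivatives

/-- Differentiating the pulled-back vector field along a flow produces the Lie bracket:
`d/dt [Z_t(y)⁻¹ Y(φ(t,y))] = Z_t(y)⁻¹ ([X_t, Y](φ(t,y)))`, where `Z_t(y) = (D_y φ)(t,y)` and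
`[X_t, Y](z) = (DY)(z)(X(t,z)) − (D_z X)(t,z)(Y(z))`. -/
theorem pullback_vector_field_derivative_is_lie_bracket
    (N : ℕ)
    (X : ℝ × EuclideanSpace ℝ (Fin N) → EuclideanSpace ℝ (Fin N))
    (Y : EuclideanSpace ℝ (Fin N) → EuclideanSpace ℝ (Fin N))
    (hX : ContDiff ℝ ∞ X) (hY : ContDiff ℝ ∞ Y)
    (φ : ℝ × EuclideanSpace ℝ (Fin N) → EuclideanSpace ℝ (Fin N))
    (hφ : ContDiff ℝ ∞ φ)
    (hflow : ∀ (t : ℝ) (y : EuclideanSpace ℝ (Fin N)),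
      HasDerivAt (fun t' => φ (t', y)) (X (t, φ (t, y))) t)
    (hinit : ∀ y, φ (0, y) = y)
    (Z : ℝ → EuclideanSpace ℝ (Fin N) →
      EuclideanSpace ℝ (Fin N) →L[ℝ] EuclideanSpace ℝ (Fin N))
    (hZ : ∀ t y, Z t y = fderiv ℝ (fun y' => φ (t, y')) y)
    (Zinv : ℝ → EuclideanSpace ℝ (Fin N) →
      EuclideanSpace ℝ (Fin N) →L[ℝ] EuclideanSpace ℝ (Fin N))
    (hZinv : ∀ t y,
      (Z t y).comp (Zinv t y) = ContinuousLinearMap.id ℝ (EuclideanSpace ℝ (Fin N)) ∧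
      (Zinv t y).comp (Z t y) = ContinuousLinearMap.id ℝ (EuclideanSpace ℝ (Fin N))) :
    ∀ (y : EuclideanSpace ℝ (Fin N)) (t : ℝ),
      HasDerivAt (fun t' => Zinv t' y (Y (φ (t', y))))
        (Zinv t y
          ((fderiv ℝ Y (φ (t, y))) (X (t, φ (t, y)))
            - (fderiv ℝ (fun z => X (t, z)) (φ (t, y))) (Y (φ (t, y))))) t := by
  intro y t
  have hφt : HasFDerivAt (fun y' => φ (t, y')) (Z t y) y := by
    rw [hZ]
    exact ((hφ.differentiable (by simp)).comp
      (differentiable_const t |>.prodMk differentiable_id) y).hasFDerivAt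
  have hXt : HasFDerivAt (fun z => X (t, z)) (fderiv ℝ (fun z => X (t, z)) (φ (t, y)))
      (φ (t, y)) :=
    ((hX.differentiable (by simp)).comp
      (differentiable_const t |>.prodMk differentiable_id) _).hasFDerivAt
  have hYt : HasDerivAt (fun t' => Y (φ (t', y))) (fderiv ℝ Y (φ (t, y)) (X (t, φ (t, y)))) t :=
    (hY.differentiable (by simp) (φ (t, y))).hasFDerivAt.comp_hasDerivAt t (hflow t y)
  have hZt : HasDerivAt (fun t' => Z t' y)
      ((fderiv ℝ (fun z => X (t, z)) (φ (t, y))).comp (Z t y)) t := by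
    have h := hasDerivAt_fderiv_snd_of_hasDerivAt_fst (contDiff_infty.1 hφ 2)
      (f := fun t y => X (t, φ (t, y))) hflow t y
    simp only [← hZ] at h
    have hchain : HasFDerivAt (fun y' => X (t, φ (t, y')))
        ((fderiv ℝ (fun z => X (t, z)) (φ (t, y))).comp (Z t y)) y :=
      HasFDerivAt.comp (g := fun z => X (t, z)) y hXt hφt
    exact h.congr_deriv hchain.fderiv
  have hZinvt := hZt.clm_inverse (B := fun t' => Zinv t' y)
    (fun s => (hZinv s y).1) (fun s => (hZinv s y).2)
  refine (hZinvt.clm_apply hYt).congr_deriv ?_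
  have hcancel : Z t y (Zinv t y (Y (φ (t, y)))) = Y (φ (t, y)) :=
    DFunLike.congr_fun (hZinv t y).1 _
  simp [hcancel, sub_eq_neg_add]
end

section
/- If f : [0, ∞) → ℝ is locally absolutely continuous with f(0) = 0, then for every t ≥ 0, f(t)² ≤ 2 ‖f′‖_{L^∞([0,t])} ‖f‖_{L¹([0,t])}; equivalently, |f(t)| ≤ √( 2 · (ess sup_{τ ∈ [0,t]} |f′(τ)|) · ∫₀ᵗ |f(τ)| dτ ). -/
open MeasureTheory

/-- If `f` is continuous on `[0, t]`, vanishes at `0` and satisfies the one-point Lipschitz bound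
`|f t - f s| ≤ M (t - s)`, then `f t ^ 2 ≤ 2 M ∫₀ᵗ |f|`. -/
theorem sq_le_two_mul_integral_abs_of_lipschitz {f : ℝ → ℝ} {M t : ℝ} (ht : 0 ≤ t)
    (hM : 0 ≤ M) (hc : ContinuousOn f (Set.Icc 0 t)) (h0 : f 0 = 0)
    (hl : ∀ s ∈ Set.Icc 0 t, |f t - f s| ≤ M * (t - s)) :
    f t ^ 2 ≤ 2 * M * ∫ τ in (0 : ℝ)..t, |f τ| := by
  have hat : |f t| ≤ M * t := by simpa [h0] using hl 0 ⟨le_rfl, ht⟩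
  rcases hM.eq_or_lt with rfl | hM
  · have : f t = 0 := by simpa using hat
    simp [this]
  set c := t - |f t| / M with hc_def
  have hct : c ≤ t := sub_le_self _ (by positivity)
  have hc0 : 0 ≤ c := by
    rw [hc_def, sub_nonneg, div_le_iff₀ hM]
    linarith
  have hfi : IntervalIntegrable (fun τ => |f τ|) volume 0 t :=
    (hc.abs.mono (by rw [Set.uIcc_of_le ht])).intervalIntegrable
  have hfi_right : IntervalIntegrable (fun τ => |f τ|) volume c t :=
    hfi.mono_set (by
      rw [Set.uIcc_of_le ht, Set.uIcc_of_le hct]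
      exact Set.Icc_subset_Icc_left hc0)
  have hlin : ∫ τ in c..t, (|f t| - M * (t - τ)) = f t ^ 2 / (2 * M) := by
    have hderiv : ∀ x ∈ Set.uIcc c t,
        HasDerivAt (fun x => |f t| * x + M * (t - x) ^ 2 / 2) (|f t| - M * (t - x)) x := by
      intro x _
      have h1 := ((hasDerivAt_id x).const_sub t).pow 2
      refine (((hasDerivAt_id x).const_mul |f t|).add
        ((h1.const_mul M).div_const 2)).congr_deriv ?_
      simp
      ring
    rw [intervalIntegral.integral_eq_sub_of_hasDerivAt hderiv
      (Continuous.intervalIntegrable (by fun_prop) _ _), hc_def, ← sq_abs (f t)]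
    field_simp
    ring
  have hle : f t ^ 2 / (2 * M) ≤ ∫ τ in (0 : ℝ)..t, |f τ| := by
    calc f t ^ 2 / (2 * M) = ∫ τ in c..t, (|f t| - M * (t - τ)) := hlin.symm
      _ ≤ ∫ τ in c..t, |f τ| := by
        refine intervalIntegral.integral_mono_on hct
          (Continuous.intervalIntegrable (by fun_prop) _ _) hfi_right fun s hs => ?_
        linarith [hl s ⟨hc0.trans hs.1, hs.2⟩, abs_sub_abs_le_abs_sub (f t) (f s)]
      _ ≤ ∫ τ in (0 : ℝ)..t, |f τ| :=
        intervalIntegral.integral_mono_interval hc0 hct le_rfl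
          (Filter.Eventually.of_forall fun _ => abs_nonneg _) hfi
  rw [div_le_iff₀ (by positivity)] at hle
  linarith

/-- If `f` is locally absolutely continuous on `[0,∞)` with `f(0) = 0` (i.e. `f(t) = ∫₀ᵗ g` for a
locally integrable `g = f′`), then `f(t)² ≤ 2 ‖f′‖_{L^∞([0,t])} ‖f‖_{L¹([0,t])}` for all `t ≥ 0`. -/
theorem sq_le_two_mul_eLpNormTop_mul_L1
    (f g : ℝ → ℝ)
    (hg : ∀ t : ℝ, 0 ≤ t → IntegrableOn g (Set.Icc (0 : ℝ) t))
    (hf : ∀ t : ℝ, 0 ≤ t → f t = ∫ τ in (0 : ℝ)..t, g τ) :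
    ∀ t : ℝ, 0 ≤ t →
      ENNReal.ofReal (f t ^ 2) ≤
        2 * eLpNorm g ⊤ (volume.restrict (Set.Icc (0 : ℝ) t)) *
          ENNReal.ofReal (∫ τ in (0 : ℝ)..t, |f τ|) := by
  intro t ht
  have h0 : f 0 = 0 := by simp [hf 0 le_rfl]
  have hcont : ContinuousOn f (Set.Icc 0 t) := by
    have := intervalIntegral.continuousOn_primitive_interval (μ := volume) (f := g) (a := 0)
      (b := t) (by rw [Set.uIcc_of_le ht]; exact hg t ht)
    rw [Set.uIcc_of_le ht] at this
    exact this.congr fun s hs => hf s hs.1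
  by_cases hft : f t = 0
  · simp [hft]
  have htpos : 0 < t := ht.lt_of_ne (by rintro rfl; exact hft h0)
  by_cases htop : eLpNorm g ⊤ (volume.restrict (Set.Icc (0 : ℝ) t)) = ⊤
  · have hpos : 0 < ∫ τ in (0 : ℝ)..t, |f τ| :=
      intervalIntegral.integral_pos htpos hcont.abs (fun _ _ => abs_nonneg _)
        ⟨t, ⟨ht, le_rfl⟩, abs_pos.mpr hft⟩
    rw [htop, ENNReal.mul_top two_ne_zero, ENNReal.top_mul (by simpa using hpos)]
    exact le_top
  set M := (eLpNorm g ⊤ (volume.restrict (Set.Icc (0 : ℝ) t))).toReal with hM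
  have hbound : ∀ᵐ x ∂volume.restrict (Set.Icc (0 : ℝ) t), ‖g x‖ ≤ M := by
    rw [eLpNorm_exponent_top] at hM htop
    filter_upwards [ae_le_eLpNormEssSup (f := g) (μ := volume.restrict (Set.Icc (0 : ℝ) t))]
      with x hx
    rw [hM, ← toReal_enorm]
    exact ENNReal.toReal_mono htop hx
  rw [ae_restrict_iff' measurableSet_Icc] at hbound
  have hlip : ∀ s ∈ Set.Icc 0 t, |f t - f s| ≤ M * (t - s) := by
    intro s hs
    have hi : ∀ u, 0 ≤ u → IntervalIntegrable g volume 0 u := fun u hu =>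
      (intervalIntegrable_iff_integrableOn_Icc_of_le hu).2 (hg u hu)
    rw [hf t ht, hf s hs.1, intervalIntegral.integral_interval_sub_left (hi t ht) (hi s hs.1),
      ← abs_of_nonneg (sub_nonneg.2 hs.2)]
    refine intervalIntegral.norm_integral_le_of_norm_le_const_ae (f := g) ?_
    filter_upwards [hbound] with x hx hxs
    rw [Set.uIoc_of_le hs.2] at hxs
    exact hx ⟨hs.1.trans hxs.1.le, hxs.2⟩
  have hmain := sq_le_two_mul_integral_abs_of_lipschitz ht ENNReal.toReal_nonneg hcont h0 hlip
  calc ENNReal.ofReal (f t ^ 2) ≤ ENNReal.ofReal (2 * M * ∫ τ in (0 : ℝ)..t, |f τ|) :=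
        ENNReal.ofReal_le_ofReal hmain
    _ = _ := by
      rw [ENNReal.ofReal_mul (by positivity), ENNReal.ofReal_mul zero_le_two, hM,
        ENNReal.ofReal_toReal htop, ENNReal.ofReal_ofNat]
end
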